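/- (Theorem 4.1) Suppose (P,Q,R,S) on U and (P̃,Q̃,R̃,S̃) on Ũ are related by the point-transformation rule via φ, and that the tilde coefficients are in special form of intermediate degeneration: Ã = 0, B̃ = 1 and P̃ = 0 identically on Ũ. Assume B ≠ 0 on U. Set φ̃₁ = −(6/5)·Q̃, φ̃₂ = −(3/5)·R̃ and define φ_i = Σ_j T^j_i·(φ̃_j∘φ) − (∂_i det T)/(det T) for i = 1,2. Then on U: φ₁ = −3·A·(A·S − B_{0.1})/(5·B²) − 3·(A_{0.1} + B_{1.0} − 3·A·R)/(5·B) − (6/5)·Q and φ₂ = 3·(A·S − B_{0.1})/(5·B) − (3/5)·R. -/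

import Mathlib

noncomputable section

open Real

/-- Partial derivative in the first argument (`f_{1.0}`). -/
def pdx (f : ℝ → ℝ → ℝ) : ℝ → ℝ → ℝ := fun x y => deriv (fun t => f t y) x

/-- Partial derivative in the second argument (`f_{0.1}`). -/
def pdy (f : ℝ → ℝ → ℝ) : ℝ → ℝ → ℝ := fun x y => deriv (fun t => f x t) y

/-- Indexed partial derivative: `0 ↦ ∂/∂x`, `1 ↦ ∂/∂y`. -/
def pd (i : Fin 2) (f : ℝ → ℝ → ℝ) : ℝ → ℝ → ℝ := if i = 0 then pdx f else pdy f

/-- Smoothness of a two-variable real function on a set `U ⊆ ℝ²`. -/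
def Smooth2 (U : Set (ℝ × ℝ)) (f : ℝ → ℝ → ℝ) : Prop :=
  ContDiffOn ℝ (⊤ : ℕ∞) (Function.uncurry f) U

/-- The quantity `A` of formula (1.6). -/
def coefA (P Q R S : ℝ → ℝ → ℝ) : ℝ → ℝ → ℝ := fun x y =>
  pdy (pdy P) x y - 2 * pdx (pdy Q) x y + pdx (pdx R) x y
    + 2 * P x y * pdx S x y + S x y * pdx P x y
    - 3 * P x y * pdy R x y - 3 * R x y * pdy P x y
    - 3 * Q x y * pdx R x y + 6 * Q x y * pdy Q x y

/-- The quantity `B` of formula (1.6). -/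
def coefB (P Q R S : ℝ → ℝ → ℝ) : ℝ → ℝ → ℝ := fun x y =>
  pdx (pdx S) x y - 2 * pdx (pdy R) x y + pdy (pdy Q) x y
    - 2 * S x y * pdy P x y - P x y * pdy S x y
    + 3 * S x y * pdx Q x y + 3 * Q x y * pdx S x y
    + 3 * R x y * pdy Q x y - 6 * R x y * pdx R x y

/-- The fully covariant symbol `θ_{ijk}` of (2.7) built from the ODE coefficients. -/
def thetaLow (P Q R S : ℝ → ℝ → ℝ) (i j k : Fin 2) : ℝ → ℝ → ℝ :=
  match i.1 + j.1 + k.1 with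
  | 0 => P
  | 1 => Q
  | 2 => R
  | _ => S

/-- The symbol `θ^k_{ij}` of (2.8), obtained by raising the first index with `d^{kr}`. -/
def thetaUp (P Q R S : ℝ → ℝ → ℝ) (k i j : Fin 2) : ℝ → ℝ → ℝ :=
  if k = 0 then thetaLow P Q R S 1 i j
  else fun x y => -(thetaLow P Q R S 0 i j x y)

/-- Jacobian matrix entry `T^p_i = ∂x̃^p/∂x^i` of the point transformation `φ = (xt, yt)`. -/
def Jmat (xt yt : ℝ → ℝ → ℝ) (p i : Fin 2) : ℝ → ℝ → ℝ :=
  pd i (if p = 0 then xt else yt)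

/-- The Jacobian determinant `det T`. -/
def Jdet (xt yt : ℝ → ℝ → ℝ) : ℝ → ℝ → ℝ := fun x y =>
  Jmat xt yt 0 0 x y * Jmat xt yt 1 1 x y - Jmat xt yt 0 1 x y * Jmat xt yt 1 0 x y

/-- The pointwise inverse Jacobian matrix `S = T⁻¹`. -/
def Jinv (xt yt : ℝ → ℝ → ℝ) (k m : Fin 2) : ℝ → ℝ → ℝ := fun x y =>
  (if k = 0 then (if m = 0 then Jmat xt yt 1 1 x y else -(Jmat xt yt 0 1 x y))
   else (if m = 0 then -(Jmat xt yt 1 0 x y) else Jmat xt yt 0 0 x y)) / Jdet xt yt x y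

/-- `σ̃_i = ∂_i (det T) / det T`. -/
def sigmaT (xt yt : ℝ → ℝ → ℝ) (i : Fin 2) : ℝ → ℝ → ℝ := fun x y =>
  pd i (Jdet xt yt) x y / Jdet xt yt x y

/-- The two coefficient systems are related by the point-transformation rule (2.9). -/
def PointRelated (U : Set (ℝ × ℝ)) (xt yt P Q R S Pt Qt Rt St : ℝ → ℝ → ℝ) : Prop :=
  ∀ i j k : Fin 2, ∀ x y : ℝ, (x, y) ∈ U →
    thetaUp P Q R S k i j x y =
      (∑ m : Fin 2, ∑ p : Fin 2, ∑ q : Fin 2,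
        Jinv xt yt k m x y * Jmat xt yt p i x y * Jmat xt yt q j x y *
          thetaUp Pt Qt Rt St m p q (xt x y) (yt x y))
      + (∑ m : Fin 2, Jinv xt yt k m x y * pd j (Jmat xt yt m i) x y)
      - (sigmaT xt yt i x y * (if k = j then (1:ℝ) else 0)
          + sigmaT xt yt j x y * (if k = i then (1:ℝ) else 0)) / 3

/-- The quantities `φ̃_j` in special coordinates: `φ̃₁ = −(6/5)·Q̃`, `φ̃₂ = −(3/5)·R̃`. -/
def phiSpec (Qt Rt : ℝ → ℝ → ℝ) (j : Fin 2) : ℝ → ℝ → ℝ :=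
  if j = 0 then fun x y => -(6/5) * Qt x y else fun x y => -(3/5) * Rt x y

/-- The quantities `φ_i = Σ_j T^j_i·(φ̃_j∘φ) − σ̃_i` of (4.13). -/
def phiPull (xt yt Qt Rt : ℝ → ℝ → ℝ) (i : Fin 2) : ℝ → ℝ → ℝ := fun x y =>
  (∑ j : Fin 2, Jmat xt yt j i x y * phiSpec Qt Rt j (xt x y) (yt x y))
    - pd i (Jdet xt yt) x y / Jdet xt yt x y


/-- Abstract differential algebra core: the Liouville tensor law in special coordinates. -/
theorem core_alg {K : Type*} [CommRing K] [Algebra ℝ K] (d1 d2 : Derivation ℝ K K)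
    (hcomm : ∀ f, d1 (d2 f) = d2 (d1 f))
    (a b c e P Q R S t1 t2 q r s q1 q2 r1 r2 s1 s2 q11 q12 q22 r11 r12 r22 s11 s12 : K)
    (hD : ∀ z, (a * e - b * c) * z = 0 → z = 0)
    (hax : d1 a = a * (Q + 2 * t1) - b * P - (q * a * a + 2 * r * a * c + s * c * c))
    (hcx : d1 c = c * (Q + 2 * t1) - e * P + (2 * q * a * c + r * c * c))
    (hay : d2 a = a * (R + t2) + b * (t1 - Q) - (q * a * b + r * (a * e + b * c) + s * c * e))
    (hbx : d1 b = a * (R + t2) + b * (t1 - Q) - (q * a * b + r * (a * e + b * c) + s * c * e))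
    (hcy : d2 c = c * (R + t2) + e * (t1 - Q) + (q * (a * e + b * c) + r * c * e))
    (hex : d1 e = c * (R + t2) + e * (t1 - Q) + (q * (a * e + b * c) + r * c * e))
    (hby : d2 b = a * S + b * (2 * t2 - R) - (q * b * b + 2 * r * b * e + s * e * e))
    (hey : d2 e = c * S + e * (2 * t2 - R) + (2 * q * b * e + r * e * e))
    (hqx : d1 q = q1 * a + q2 * c) (hqy : d2 q = q1 * b + q2 * e)
    (hrx : d1 r = r1 * a + r2 * c) (hry : d2 r = r1 * b + r2 * e)
    (hsx : d1 s = s1 * a + s2 * c) (hsy : d2 s = s1 * b + s2 * e)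
    (hq1x : d1 q1 = q11 * a + q12 * c) (hq1y : d2 q1 = q11 * b + q12 * e)
    (hq2x : d1 q2 = q12 * a + q22 * c) (hq2y : d2 q2 = q12 * b + q22 * e)
    (hr1x : d1 r1 = r11 * a + r12 * c) (hr1y : d2 r1 = r11 * b + r12 * e)
    (hr2x : d1 r2 = r12 * a + r22 * c) (hr2y : d2 r2 = r12 * b + r22 * e)
    (hs1x : d1 s1 = s11 * a + s12 * c) (hs1y : d2 s1 = s11 * b + s12 * e)
    (hA : -2 * q12 + r11 - 3 * q * r1 + 6 * q * q2 = 0)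
    (hB : s11 - 2 * r12 + q22 + 3 * s * q1 + 3 * q * s1 + 3 * r * q2 - 6 * r * r1 = 1) :
    d2 (d2 P) - 2 * d1 (d2 Q) + d1 (d1 R) + 2 * P * d1 S + S * d1 P - 3 * P * d2 R
      - 3 * R * d2 P - 3 * Q * d1 R + 6 * Q * d2 Q = (a * e - b * c) * c ∧
    d1 (d1 S) - 2 * d1 (d2 R) + d2 (d2 Q) - 2 * S * d2 P - P * d2 S + 3 * S * d1 Q
      + 3 * Q * d1 S + 3 * R * d2 Q - 6 * R * d1 R = (a * e - b * c) * e := by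
  have n1 : d1 2 = 0 := by simpa using d1.map_natCast 2
  have n2 : d2 2 = 0 := by simpa using d2.map_natCast 2
  -- closedness of t
  have hDx : d1 (a * e - b * c) = 3 * t1 * (a * e - b * c) := by
    simp only [map_sub, Derivation.leibniz, smul_eq_mul, hax, hcx, hbx, hex]
    ring
  have hDy : d2 (a * e - b * c) = 3 * t2 * (a * e - b * c) := by
    simp only [map_sub, Derivation.leibniz, smul_eq_mul, hay, hcy, hby, hey]
    ring
  have n13 : d1 3 = 0 := by simpa using d1.map_natCast 3
  have n23 : d2 3 = 0 := by simpa using d2.map_natCast 3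
  have three : ∀ z : K, 3 * z = 0 → z = 0 := by
    intro z hz
    have h : (3 : ℝ) • z = 0 := by
      rw [Algebra.smul_def, map_ofNat]; exact hz
    have := congrArg (fun w => (3⁻¹ : ℝ) • w) h
    simpa [smul_smul] using this
  have hclosed : d1 t2 = d2 t1 := by
    have h := hcomm (a * e - b * c)
    rw [hDx, hDy] at h
    simp only [Derivation.leibniz, smul_eq_mul, hDx, hDy, n13, n23] at h
    refine sub_eq_zero.1 (hD _ (three _ ?_))
    linear_combination h
  have Ea := hcomm a
  have Eb := hcomm b
  have Ec := hcomm c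
  have Ee := hcomm e
  rw [hax, hay] at Ea
  rw [hbx, hby] at Eb
  rw [hcx, hcy] at Ec
  rw [hex, hey] at Ee
  simp only [map_sub, map_add, Derivation.leibniz, smul_eq_mul, hax, hcx, hbx, hex, hay, hcy,
    hby, hey, hqx, hqy, hrx, hry, hsx, hsy, n1, n2, hclosed] at Ea Eb Ec Ee
  have H11 : d1 t1 = d1 Q - d2 P - 2 * Q * Q + 2 * P * R + Q * t1 - P * t2 + t1 * t1
      - (a * a * (q1 - 2 * q * q) + 2 * a * c * (r1 - q2 - q * r)
        + c * c * (s1 - r2 - 2 * r * r + 2 * q * s)) := by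
    refine sub_eq_zero.1 (hD _ ?_)
    linear_combination a * Ec - c * Ea
  have H22 : d2 t2 = d1 S - d2 R - 2 * R * R + 2 * Q * S + S * t1 - R * t2 + t2 * t2
      - (b * b * (q1 - 2 * q * q) + 2 * b * e * (r1 - q2 - q * r)
        + e * e * (s1 - r2 - 2 * r * r + 2 * q * s)) := by
    refine sub_eq_zero.1 (hD _ ?_)
    linear_combination b * Ee - e * Eb
  have H12 : d2 t1 = d1 R - d2 Q - Q * R + P * S + R * t1 - Q * t2 + t1 * t2
      - (a * b * (q1 - 2 * q * q) + (a * e + b * c) * (r1 - q2 - q * r)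
        + c * e * (s1 - r2 - 2 * r * r + 2 * q * s)) := by
    refine sub_eq_zero.1 (hD _ ?_)
    linear_combination b * Ec - e * Ea
  have F1 := hcomm t1
  have F2 := hcomm t2
  rw [H11, H12] at F1
  rw [hclosed, H22, H12] at F2
  simp only [map_sub, map_add, Derivation.leibniz, smul_eq_mul, hax, hcx, hbx, hex, hay, hcy,
    hby, hey, hqx, hqy, hrx, hry, hsx, hsy, hq1x, hq1y, hq2x, hq2y, hr1x, hr1y, hr2x, hr2y,
    hs1x, hs1y, n1, n2, hclosed, H11, H22, H12, hcomm] at F1 F2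
  rw [hcomm Q, hcomm R]
  constructor
  · linear_combination (a * e - b * c) * (a * hA + c * hB) + F1
  · linear_combination (a * e - b * c) * (b * hA + e * hB) + F2

/-- The algebra of smooth functions on `U` (as functions on the subtype). -/
def SmAlg (U : Set (ℝ × ℝ)) : Subalgebra ℝ (U → ℝ) where
  carrier := {f | ∃ g : ℝ × ℝ → ℝ, ContDiffOn ℝ (⊤ : ℕ∞) g U ∧ ∀ z : U, f z = g z}
  mul_mem' := by
    rintro f f' ⟨g, hg, h⟩ ⟨g', hg', h'⟩
    exact ⟨fun z => g z * g' z, hg.mul hg', fun z => by simp [h, h']⟩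
  add_mem' := by
    rintro f f' ⟨g, hg, h⟩ ⟨g', hg', h'⟩
    exact ⟨fun z => g z + g' z, hg.add hg', fun z => by simp [h, h']⟩
  algebraMap_mem' := fun r => ⟨fun _ => r, contDiffOn_const, fun z => by simp⟩

/-- A chosen smooth representative. -/
def rep {U : Set (ℝ × ℝ)} (f : SmAlg U) : ℝ × ℝ → ℝ := f.2.choose

theorem rep_smooth {U : Set (ℝ × ℝ)} (f : SmAlg U) : ContDiffOn ℝ (⊤ : ℕ∞) (rep f) U :=
  f.2.choose_spec.1

theorem rep_val {U : Set (ℝ × ℝ)} (f : SmAlg U) (z : U) : f.1 z = rep f z :=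
  f.2.choose_spec.2 z

theorem fderiv_congr_open {U : Set (ℝ × ℝ)} (hU : IsOpen U) {g g' : ℝ × ℝ → ℝ}
    (h : ∀ z ∈ U, g z = g' z) {z : ℝ × ℝ} (hz : z ∈ U) : fderiv ℝ g z = fderiv ℝ g' z :=
  Filter.EventuallyEq.fderiv_eq (by filter_upwards [hU.mem_nhds hz] with w hw using h w hw)

theorem diffAt_of_smooth {U : Set (ℝ × ℝ)} (hU : IsOpen U) {g : ℝ × ℝ → ℝ}
    (hg : ContDiffOn ℝ (⊤ : ℕ∞) g U) {z : ℝ × ℝ} (hz : z ∈ U) : DifferentiableAt ℝ g z :=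
  (hg.contDiffAt (hU.mem_nhds hz)).differentiableAt (by simp)

theorem smooth_fderiv {U : Set (ℝ × ℝ)} (hU : IsOpen U) {g : ℝ × ℝ → ℝ}
    (hg : ContDiffOn ℝ (⊤ : ℕ∞) g U) (v : ℝ × ℝ) :
    ContDiffOn ℝ (⊤ : ℕ∞) (fun z => fderiv ℝ g z v) U :=
  (hg.fderiv_of_isOpen hU (m := (⊤ : ℕ∞)) (by simp)).clm_apply contDiffOn_const

/-- Directional derivative as a derivation of the algebra of smooth functions. -/
def dirD {U : Set (ℝ × ℝ)} (hU : IsOpen U) (v : ℝ × ℝ) : Derivation ℝ (SmAlg U) (SmAlg U) :=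
  Derivation.mk'
    { toFun := fun f => ⟨fun z => fderiv ℝ (rep f) z v,
        ⟨_, smooth_fderiv hU (rep_smooth f) v, fun _ => rfl⟩⟩
      map_add' := by
        intro f g
        ext ⟨z, hz⟩
        have h : fderiv ℝ (rep (f + g)) z = fderiv ℝ (fun w => rep f w + rep g w) z :=
          fderiv_congr_open hU (fun w hw => by
            rw [← rep_val (f + g) ⟨w, hw⟩, ← rep_val f ⟨w, hw⟩, ← rep_val g ⟨w, hw⟩]; rfl) hz
        show fderiv ℝ (rep (f + g)) z v = fderiv ℝ (rep f) z v + fderiv ℝ (rep g) z v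
        rw [h, fderiv_fun_add (diffAt_of_smooth hU (rep_smooth f) hz)
          (diffAt_of_smooth hU (rep_smooth g) hz)]
        rfl
      map_smul' := by
        intro r f
        ext ⟨z, hz⟩
        have h : fderiv ℝ (rep (r • f)) z = fderiv ℝ (fun w => r • rep f w) z :=
          fderiv_congr_open hU (fun w hw => by
            rw [← rep_val (r • f) ⟨w, hw⟩, ← rep_val f ⟨w, hw⟩]; rfl) hz
        show fderiv ℝ (rep (r • f)) z v = r • fderiv ℝ (rep f) z v
        rw [h, fderiv_fun_const_smul (diffAt_of_smooth hU (rep_smooth f) hz)]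
        rfl }
    (by
      intro f g
      ext ⟨z, hz⟩
      have h : fderiv ℝ (rep (f * g)) z = fderiv ℝ (fun w => rep f w * rep g w) z :=
        fderiv_congr_open hU (fun w hw => by
          rw [← rep_val (f * g) ⟨w, hw⟩, ← rep_val f ⟨w, hw⟩, ← rep_val g ⟨w, hw⟩]; rfl) hz
      show fderiv ℝ (rep (f * g)) z v
        = f.1 ⟨z, hz⟩ * fderiv ℝ (rep g) z v + g.1 ⟨z, hz⟩ * fderiv ℝ (rep f) z v
      rw [h, fderiv_fun_mul (diffAt_of_smooth hU (rep_smooth f) hz)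
        (diffAt_of_smooth hU (rep_smooth g) hz), rep_val f, rep_val g]
      rfl)

theorem dirD_val {U : Set (ℝ × ℝ)} (hU : IsOpen U) (v : ℝ × ℝ) (f : SmAlg U) (z : U) :
    (dirD hU v f).1 z = fderiv ℝ (rep f) z v := rfl

theorem dirD_val' {U : Set (ℝ × ℝ)} (hU : IsOpen U) (v : ℝ × ℝ) (f : SmAlg U)
    (g : ℝ × ℝ → ℝ) (h : ∀ z : U, f.1 z = g z) (z : U) :
    (dirD hU v f).1 z = fderiv ℝ g z v := by
  rw [dirD_val, fderiv_congr_open hU (fun w hw => ?_) z.2]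
  rw [← rep_val f ⟨w, hw⟩, h ⟨w, hw⟩]

theorem dirD_comm {U : Set (ℝ × ℝ)} (hU : IsOpen U) (v w : ℝ × ℝ) (f : SmAlg U) :
    dirD hU v (dirD hU w f) = dirD hU w (dirD hU v f) := by
  ext z
  rw [dirD_val' hU v _ (fun z => fderiv ℝ (rep f) z w) (fun z => rfl),
    dirD_val' hU w _ (fun z => fderiv ℝ (rep f) z v) (fun z => rfl)]
  have hc := (rep_smooth f).contDiffAt (hU.mem_nhds z.2)
  have hd : DifferentiableAt ℝ (fderiv ℝ (rep f)) z :=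
    (hc.fderiv_right (m := (⊤ : ℕ∞)) (by simp)).differentiableAt (by simp)
  have hs : IsSymmSndFDerivAt ℝ (rep f) z := hc.isSymmSndFDerivAt (by
    simp only [minSmoothness_of_isRCLikeNormedField]
    exact (WithTop.coe_le_coe.2 le_top : ((2 : ℕ∞) : WithTop ℕ∞) ≤ ((⊤ : ℕ∞) : WithTop ℕ∞)))
  rw [fderiv_clm_apply hd (differentiableAt_const _), fderiv_clm_apply hd (differentiableAt_const _)]
  simpa using hs v w

theorem pdx_eq_fderiv {g : ℝ → ℝ → ℝ} {x y : ℝ}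
    (h : DifferentiableAt ℝ (Function.uncurry g) (x, y)) :
    pdx g x y = fderiv ℝ (Function.uncurry g) (x, y) (1, 0) := by
  have h1 : HasDerivAt (fun t : ℝ => (t, y)) ((1 : ℝ), (0 : ℝ)) x :=
    (hasDerivAt_id x).prodMk (hasDerivAt_const x y)
  exact (HasFDerivAt.comp_hasDerivAt x h.hasFDerivAt h1).deriv

theorem pdy_eq_fderiv {g : ℝ → ℝ → ℝ} {x y : ℝ}
    (h : DifferentiableAt ℝ (Function.uncurry g) (x, y)) :
    pdy g x y = fderiv ℝ (Function.uncurry g) (x, y) (0, 1) := by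
  have h1 : HasDerivAt (fun t : ℝ => (x, t)) ((0 : ℝ), (1 : ℝ)) y :=
    (hasDerivAt_const y x).prodMk (hasDerivAt_id y)
  exact (HasFDerivAt.comp_hasDerivAt y h.hasFDerivAt h1).deriv

/-- `f` in the algebra represents the two-variable function `g` on `U`. -/
def Reps {U : Set (ℝ × ℝ)} (f : SmAlg U) (g : ℝ → ℝ → ℝ) : Prop :=
  ∀ z : U, f.1 z = g z.1.1 z.1.2

theorem Reps.smooth {U : Set (ℝ × ℝ)} {f : SmAlg U} {g : ℝ → ℝ → ℝ} (h : Reps f g) :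
    Smooth2 U g :=
  (rep_smooth f).congr (fun z hz => by rw [← rep_val f ⟨z, hz⟩, h ⟨z, hz⟩]; rfl)

theorem Reps.dx {U : Set (ℝ × ℝ)} (hU : IsOpen U) {f : SmAlg U} {g : ℝ → ℝ → ℝ}
    (h : Reps f g) : Reps (dirD hU (1, 0) f) (pdx g) := by
  rintro ⟨⟨x, y⟩, hz⟩
  rw [dirD_val' hU _ f (Function.uncurry g) h]
  exact (pdx_eq_fderiv (diffAt_of_smooth hU h.smooth hz)).symm

theorem Reps.dy {U : Set (ℝ × ℝ)} (hU : IsOpen U) {f : SmAlg U} {g : ℝ → ℝ → ℝ}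
    (h : Reps f g) : Reps (dirD hU (0, 1) f) (pdy g) := by
  rintro ⟨⟨x, y⟩, hz⟩
  rw [dirD_val' hU _ f (Function.uncurry g) h]
  exact (pdy_eq_fderiv (diffAt_of_smooth hU h.smooth hz)).symm

/-- The element of the algebra given by a smooth function. -/
def mkS {U : Set (ℝ × ℝ)} (g : ℝ → ℝ → ℝ) (h : Smooth2 U g) : SmAlg U :=
  ⟨fun z => g z.1.1 z.1.2, ⟨Function.uncurry g, h, fun _ => rfl⟩⟩

theorem reps_mkS {U : Set (ℝ × ℝ)} (g : ℝ → ℝ → ℝ) (h : Smooth2 U g) : Reps (mkS g h) g :=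
  fun _ => rfl

theorem smooth_pdx {U : Set (ℝ × ℝ)} (hU : IsOpen U) {g : ℝ → ℝ → ℝ} (h : Smooth2 U g) :
    Smooth2 U (pdx g) := ((reps_mkS g h).dx hU).smooth

theorem smooth_pdy {U : Set (ℝ × ℝ)} (hU : IsOpen U) {g : ℝ → ℝ → ℝ} (h : Smooth2 U g) :
    Smooth2 U (pdy g) := ((reps_mkS g h).dy hU).smooth

theorem pd_comm {U : Set (ℝ × ℝ)} (hU : IsOpen U) {g : ℝ → ℝ → ℝ} (h : Smooth2 U g)
    {x y : ℝ} (hz : (x, y) ∈ U) : pdx (pdy g) x y = pdy (pdx g) x y := by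
  rw [← ((reps_mkS g h).dy hU).dx hU ⟨(x, y), hz⟩, ← ((reps_mkS g h).dx hU).dy hU ⟨(x, y), hz⟩,
    dirD_comm]

theorem smooth_comp {U Ut : Set (ℝ × ℝ)} {xt yt : ℝ → ℝ → ℝ} (hxt : Smooth2 U xt)
    (hyt : Smooth2 U yt) (hmaps : ∀ x y : ℝ, (x, y) ∈ U → (xt x y, yt x y) ∈ Ut)
    {g : ℝ → ℝ → ℝ} (hg : Smooth2 Ut g) : Smooth2 U (fun x y => g (xt x y) (yt x y)) :=
  ContDiffOn.comp (g := Function.uncurry g)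
    (f := fun z : ℝ × ℝ => (xt z.1 z.2, yt z.1 z.2)) hg (hxt.prodMk hyt)
    (fun z hz => hmaps z.1 z.2 hz)

theorem pd_comp {U Ut : Set (ℝ × ℝ)} (hU : IsOpen U) (hUt : IsOpen Ut) {xt yt : ℝ → ℝ → ℝ}
    (hxt : Smooth2 U xt)
    (hyt : Smooth2 U yt) (hmaps : ∀ x y : ℝ, (x, y) ∈ U → (xt x y, yt x y) ∈ Ut)
    {g : ℝ → ℝ → ℝ} (hg : Smooth2 Ut g) {x y : ℝ} (hz : (x, y) ∈ U) :
    pdx (fun x y => g (xt x y) (yt x y)) x y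
      = pdx g (xt x y) (yt x y) * pdx xt x y + pdy g (xt x y) (yt x y) * pdx yt x y ∧
    pdy (fun x y => g (xt x y) (yt x y)) x y
      = pdx g (xt x y) (yt x y) * pdy xt x y + pdy g (xt x y) (yt x y) * pdy yt x y := by
  have hgd := diffAt_of_smooth hUt hg (hmaps x y hz)
  have hxd := diffAt_of_smooth hU hxt hz
  have hyd := diffAt_of_smooth hU hyt hz
  have hcd := diffAt_of_smooth hU (smooth_comp hxt hyt hmaps hg) hz
  have hf : HasFDerivAt (Function.uncurry fun x y => g (xt x y) (yt x y))
      ((fderiv ℝ (Function.uncurry g) (xt x y, yt x y)).comp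
        ((fderiv ℝ (Function.uncurry xt) (x, y)).prod (fderiv ℝ (Function.uncurry yt) (x, y))))
      (x, y) :=
    HasFDerivAt.comp (g := Function.uncurry g)
      (f := fun z : ℝ × ℝ => (Function.uncurry xt z, Function.uncurry yt z)) (x, y)
      hgd.hasFDerivAt (hxd.hasFDerivAt.prodMk hyd.hasFDerivAt)
  have key : ∀ s t : ℝ, fderiv ℝ (Function.uncurry g) (xt x y, yt x y) (s, t)
      = pdx g (xt x y) (yt x y) * s + pdy g (xt x y) (yt x y) * t := by
    intro s t
    have : ((s, t) : ℝ × ℝ) = s • (1, 0) + t • (0, 1) := by simp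
    rw [this, map_add, map_smul, map_smul, pdx_eq_fderiv hgd, pdy_eq_fderiv hgd]
    simp [mul_comm]
  rw [pdx_eq_fderiv hcd, pdy_eq_fderiv hcd, hf.fderiv, pdx_eq_fderiv hxd, pdx_eq_fderiv hyd,
    pdy_eq_fderiv hxd, pdy_eq_fderiv hyd]
  exact ⟨key _ _, key _ _⟩

/-- The pointwise form of the transformation rule solved for second derivatives. -/
theorem rel_solved {U : Set (ℝ × ℝ)} {xt yt P Q R S Pt Qt Rt St : ℝ → ℝ → ℝ}
    (hrel : PointRelated U xt yt P Q R S Pt Qt Rt St) {x y : ℝ} (hz : (x, y) ∈ U)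
    (hdet : Jdet xt yt x y ≠ 0) (hP0 : Pt (xt x y) (yt x y) = 0)
    {a b c e q r s t1 t2 P0 Q0 R0 S0 : ℝ} (ha : a = pdx xt x y) (hb : b = pdy xt x y)
    (hc : c = pdx yt x y) (he : e = pdy yt x y)
    (hq : q = Qt (xt x y) (yt x y)) (hr : r = Rt (xt x y) (yt x y))
    (hs : s = St (xt x y) (yt x y)) (h1 : t1 = sigmaT xt yt 0 x y / 3)
    (h2 : t2 = sigmaT xt yt 1 x y / 3)
    (hP : P0 = P x y) (hQ : Q0 = Q x y) (hR : R0 = R x y) (hS : S0 = S x y) :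
    (pdx (pdx xt) x y
      = a * (Q0 + 2 * t1) - b * P0 - (q * a * a + 2 * r * a * c + s * c * c)) ∧
    (pdx (pdx yt) x y = c * (Q0 + 2 * t1) - e * P0 + (2 * q * a * c + r * c * c)) ∧
    (pdy (pdx xt) x y
      = a * (R0 + t2) + b * (t1 - Q0) - (q * a * b + r * (a * e + b * c) + s * c * e)) ∧
    (pdx (pdy xt) x y
      = a * (R0 + t2) + b * (t1 - Q0) - (q * a * b + r * (a * e + b * c) + s * c * e)) ∧
    (pdy (pdx yt) x y
      = c * (R0 + t2) + e * (t1 - Q0) + (q * (a * e + b * c) + r * c * e)) ∧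
    (pdx (pdy yt) x y
      = c * (R0 + t2) + e * (t1 - Q0) + (q * (a * e + b * c) + r * c * e)) ∧
    (pdy (pdy xt) x y
      = a * S0 + b * (2 * t2 - R0) - (q * b * b + 2 * r * b * e + s * e * e)) ∧
    (pdy (pdy yt) x y = c * S0 + e * (2 * t2 - R0) + (2 * q * b * e + r * e * e)) := by
  obtain ⟨D, hD⟩ : ∃ D, D = Jdet xt yt x y := ⟨_, rfl⟩
  obtain ⟨i, hi⟩ : ∃ i, i = (Jdet xt yt x y)⁻¹ := ⟨_, rfl⟩
  have hiD : (a * e - b * c) * i = 1 := by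
    have : a * e - b * c = Jdet xt yt x y := by
      subst ha hb hc he; simp [Jdet, Jmat, pd]
    rw [this, hi, mul_inv_cancel₀ hdet]
  have e1 : sigmaT xt yt 0 x y = 3 * t1 := by rw [h1]; ring
  have e2 : sigmaT xt yt 1 x y = 3 * t2 := by rw [h2]; ring
  have E := fun i j k => hrel i j k x y hz
  have h000 := E 0 0 0
  have h001 := E 0 0 1
  have h010 := E 0 1 0
  have h011 := E 0 1 1
  have h100 := E 1 0 0
  have h101 := E 1 0 1
  have h110 := E 1 1 0
  have h111 := E 1 1 1
  clear E
  simp [thetaUp, thetaLow, Jinv, Fin.sum_univ_two, Jmat, pd, e1, e2, hP0, ← hq, ← hr, ← hs,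
    ← ha, ← hb, ← hc, ← he, ← hP, ← hQ, ← hR, ← hS, div_eq_mul_inv, ← hi]
    at h000 h001 h010 h011 h100 h101 h110 h111
  refine ⟨?_, ?_, ?_, ?_, ?_, ?_, ?_, ?_⟩
  · linear_combination -a * h000 - b * h001
      - (pdx (pdx xt) x y + (q * a * a + 2 * r * a * c + s * c * c)) * hiD
  · linear_combination -c * h000 - e * h001
      - (pdx (pdx yt) x y - (2 * q * a * c + r * c * c)) * hiD
  · linear_combination -a * h010 - b * h011
      - (pdy (pdx xt) x y + (q * a * b + r * (a * e + b * c) + s * c * e)) * hiD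
  · linear_combination -a * h100 - b * h101
      - (pdx (pdy xt) x y + (q * a * b + r * (a * e + b * c) + s * c * e)) * hiD
  · linear_combination -c * h010 - e * h011
      - (pdy (pdx yt) x y - (q * (a * e + b * c) + r * c * e)) * hiD
  · linear_combination -c * h100 - e * h101
      - (pdx (pdy yt) x y - (q * (a * e + b * c) + r * c * e)) * hiD
  · linear_combination -a * h110 - b * h111
      - (pdy (pdy xt) x y + (q * b * b + 2 * r * b * e + s * e * e)) * hiD
  · linear_combination -c * h110 - e * h111
      - (pdy (pdy yt) x y - (2 * q * b * e + r * e * e)) * hiD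

/-- Derivatives of the transformed covector. -/
theorem core_deriv {K : Type*} [CommRing K] [Algebra ℝ K] (d1 d2 : Derivation ℝ K K)
    (a b c e P Q R S t1 t2 q r s : K)
    (hax : d1 a = a * (Q + 2 * t1) - b * P - (q * a * a + 2 * r * a * c + s * c * c))
    (hcx : d1 c = c * (Q + 2 * t1) - e * P + (2 * q * a * c + r * c * c))
    (hay : d2 a = a * (R + t2) + b * (t1 - Q) - (q * a * b + r * (a * e + b * c) + s * c * e))
    (hbx : d1 b = a * (R + t2) + b * (t1 - Q) - (q * a * b + r * (a * e + b * c) + s * c * e))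
    (hcy : d2 c = c * (R + t2) + e * (t1 - Q) + (q * (a * e + b * c) + r * c * e))
    (hex : d1 e = c * (R + t2) + e * (t1 - Q) + (q * (a * e + b * c) + r * c * e))
    (hby : d2 b = a * S + b * (2 * t2 - R) - (q * b * b + 2 * r * b * e + s * e * e))
    (hey : d2 e = c * S + e * (2 * t2 - R) + (2 * q * b * e + r * e * e)) :
    d2 ((a * e - b * c) * c) = (a * e - b * c) * (3 * t2 * c
      + (c * (R + t2) + e * (t1 - Q) + (q * (a * e + b * c) + r * c * e))) ∧
    d1 ((a * e - b * c) * e) = (a * e - b * c) * (3 * t1 * e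
      + (c * (R + t2) + e * (t1 - Q) + (q * (a * e + b * c) + r * c * e))) ∧
    d2 ((a * e - b * c) * e) = (a * e - b * c) * (3 * t2 * e
      + (c * S + e * (2 * t2 - R) + (2 * q * b * e + r * e * e))) := by
  simp only [map_sub, Derivation.leibniz, smul_eq_mul, hax, hcx, hbx, hex, hay, hcy, hby, hey]
  refine ⟨?_, ?_, ?_⟩ <;> ring

/-- The last, purely algebraic step. -/
theorem final_alg {a b c e Q R S t1 t2 q r D A B Ay Bx By : ℝ} (hDn : D ≠ 0)
    (hD : D = a * e - b * c)
    (hA : A = D * c) (hB : B = D * e) (hBn : B ≠ 0)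
    (hAy : Ay = D * (3 * t2 * c
      + (c * (R + t2) + e * (t1 - Q) + (q * (a * e + b * c) + r * c * e))))
    (hBx : Bx = D * (3 * t1 * e
      + (c * (R + t2) + e * (t1 - Q) + (q * (a * e + b * c) + r * c * e))))
    (hBy : By = D * (3 * t2 * e
      + (c * S + e * (2 * t2 - R) + (2 * q * b * e + r * e * e)))) :
    a * (-(6/5) * q) + c * (-(3/5) * r) - 3 * t1
      = -3 * A * (A * S - By) / (5 * B ^ 2) - 3 * (Ay + Bx - 3 * A * R) / (5 * B)
        - (6/5) * Q ∧
    b * (-(6/5) * q) + e * (-(3/5) * r) - 3 * t2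
      = 3 * (A * S - By) / (5 * B) - (3/5) * R := by
  have he : e ≠ 0 := by rintro rfl; exact hBn (by rw [hB, mul_zero])
  clear hD
  subst hA hB hAy hBx hBy
  constructor
  · field_simp
    ring
  · field_simp
    ring

/-- Theorem 4.1: effective formulas (4.8) for `φ₁`, `φ₂` when `B ≠ 0`. -/
theorem phi_effective_formulas_B_ne_zero
    (U Ut : Set (ℝ × ℝ)) (hU : IsOpen U) (hUconn : IsConnected U) (hUt : IsOpen Ut)
    (xt yt : ℝ → ℝ → ℝ) (hxt : Smooth2 U xt) (hyt : Smooth2 U yt)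
    (hmaps : ∀ x y : ℝ, (x, y) ∈ U → (xt x y, yt x y) ∈ Ut)
    (hdet : ∀ x y : ℝ, (x, y) ∈ U → Jdet xt yt x y ≠ 0)
    (P Q R S Pt Qt Rt St : ℝ → ℝ → ℝ)
    (hP : Smooth2 U P) (hQ : Smooth2 U Q) (hR : Smooth2 U R) (hS : Smooth2 U S)
    (hPt : Smooth2 Ut Pt) (hQt : Smooth2 Ut Qt) (hRt : Smooth2 Ut Rt) (hSt : Smooth2 Ut St)
    (hrel : PointRelated U xt yt P Q R S Pt Qt Rt St)
    (hspec : ∀ x y : ℝ, (x, y) ∈ Ut →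
      coefA Pt Qt Rt St x y = 0 ∧ coefB Pt Qt Rt St x y = 1 ∧ Pt x y = 0)
    (hB : ∀ x y : ℝ, (x, y) ∈ U → coefB P Q R S x y ≠ 0) :
    ∀ x y : ℝ, (x, y) ∈ U →
      phiPull xt yt Qt Rt 0 x y =
        -3 * coefA P Q R S x y *
            (coefA P Q R S x y * S x y - pdy (coefB P Q R S) x y)
            / (5 * (coefB P Q R S x y)^2)
        - 3 * (pdy (coefA P Q R S) x y + pdx (coefB P Q R S) x y
            - 3 * coefA P Q R S x y * R x y) / (5 * coefB P Q R S x y)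
        - (6/5) * Q x y ∧
      phiPull xt yt Qt Rt 1 x y =
        3 * (coefA P Q R S x y * S x y - pdy (coefB P Q R S) x y)
            / (5 * coefB P Q R S x y)
        - (3/5) * R x y := by
  have sax := smooth_pdx hU hxt
  have say := smooth_pdy hU hxt
  have scx := smooth_pdx hU hyt
  have scy := smooth_pdy hU hyt
  have sD : Smooth2 U (Jdet xt yt) := (sax.mul scy).sub (say.mul scx)
  have hdet2 : ∀ z ∈ U, Function.uncurry (Jdet xt yt) z ≠ 0 := fun z hz => hdet z.1 z.2 hz
  have st1 : Smooth2 U (fun x y => sigmaT xt yt 0 x y / 3) :=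
    ((smooth_pdx hU sD).div sD hdet2).div_const 3
  have st2 : Smooth2 U (fun x y => sigmaT xt yt 1 x y / 3) :=
    ((smooth_pdy hU sD).div sD hdet2).div_const 3
  have cm : ∀ {g : ℝ → ℝ → ℝ}, Smooth2 Ut g → Smooth2 U (fun x y => g (xt x y) (yt x y)) :=
    fun hg => smooth_comp hxt hyt hmaps hg
  have sq1 := smooth_pdx hUt hQt
  have sq2 := smooth_pdy hUt hQt
  have sr1 := smooth_pdx hUt hRt
  have sr2 := smooth_pdy hUt hRt
  have ss1 := smooth_pdx hUt hSt
  have ss2 := smooth_pdy hUt hSt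
  -- the chain rule inside the algebra
  have chx : ∀ {g : ℝ → ℝ → ℝ} (hg : Smooth2 Ut g) (g1 g2 : ℝ → ℝ → ℝ) (h1 : Smooth2 Ut g1)
      (h2 : Smooth2 Ut g2) (_ : ∀ x y, (x, y) ∈ Ut → pdx g x y = g1 x y)
      (_ : ∀ x y, (x, y) ∈ Ut → pdy g x y = g2 x y),
      dirD hU (1, 0) (mkS _ (cm hg)) = mkS _ (cm h1) * mkS _ sax + mkS _ (cm h2) * mkS _ scx := by
    intro g hg g1 g2 h1 h2 e1 e2
    ext ⟨⟨x, y⟩, hz⟩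
    rw [(reps_mkS _ (cm hg)).dx hU ⟨(x, y), hz⟩]
    have := (pd_comp hU hUt hxt hyt hmaps hg hz).1
    rw [e1 _ _ (hmaps x y hz), e2 _ _ (hmaps x y hz)] at this
    exact this
  have chy : ∀ {g : ℝ → ℝ → ℝ} (hg : Smooth2 Ut g) (g1 g2 : ℝ → ℝ → ℝ) (h1 : Smooth2 Ut g1)
      (h2 : Smooth2 Ut g2) (_ : ∀ x y, (x, y) ∈ Ut → pdx g x y = g1 x y)
      (_ : ∀ x y, (x, y) ∈ Ut → pdy g x y = g2 x y),
      dirD hU (0, 1) (mkS _ (cm hg)) = mkS _ (cm h1) * mkS _ say + mkS _ (cm h2) * mkS _ scy := by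
    intro g hg g1 g2 h1 h2 e1 e2
    ext ⟨⟨x, y⟩, hz⟩
    rw [(reps_mkS _ (cm hg)).dy hU ⟨(x, y), hz⟩]
    have := (pd_comp hU hUt hxt hyt hmaps hg hz).2
    rw [e1 _ _ (hmaps x y hz), e2 _ _ (hmaps x y hz)] at this
    exact this
  have rfl2 : ∀ f : ℝ → ℝ → ℝ, ∀ x y, (x, y) ∈ Ut → f x y = f x y := fun _ _ _ _ => rfl
  have cQ : ∀ x y, (x, y) ∈ Ut → pdy (pdx Qt) x y = pdx (pdy Qt) x y :=
    fun x y h => (pd_comm hUt hQt h).symm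
  have cR : ∀ x y, (x, y) ∈ Ut → pdy (pdx Rt) x y = pdx (pdy Rt) x y :=
    fun x y h => (pd_comm hUt hRt h).symm
  have cS : ∀ x y, (x, y) ∈ Ut → pdy (pdx St) x y = pdx (pdy St) x y :=
    fun x y h => (pd_comm hUt hSt h).symm
  have sq11 := smooth_pdx hUt sq1
  have sq12 := smooth_pdx hUt sq2
  have sq22 := smooth_pdy hUt sq2
  have sr11 := smooth_pdx hUt sr1
  have sr12 := smooth_pdx hUt sr2
  have sr22 := smooth_pdy hUt sr2
  have ss11 := smooth_pdx hUt ss1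
  have ss12 := smooth_pdx hUt ss2
  -- P̃ and its derivatives vanish
  have P0 : ∀ x y, (x, y) ∈ Ut → Pt x y = 0 := fun x y h => (hspec x y h).2.2
  have zer : ∀ g : ℝ → ℝ → ℝ, (∀ x y, (x, y) ∈ Ut → g x y = 0) →
      ∀ x y, (x, y) ∈ Ut → pdx g x y = 0 ∧ pdy g x y = 0 := by
    intro g hg x y h
    have hr : Reps (0 : SmAlg Ut) g := fun z => (hg z.1.1 z.1.2 z.2).symm
    have h1 := hr.dx hUt ⟨(x, y), h⟩
    have h2 := hr.dy hUt ⟨(x, y), h⟩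
    rw [map_zero] at h1 h2
    exact ⟨h1.symm, h2.symm⟩
  have P1 : ∀ x y, (x, y) ∈ Ut → pdx Pt x y = 0 := fun x y h => (zer Pt P0 x y h).1
  have P2 : ∀ x y, (x, y) ∈ Ut → pdy Pt x y = 0 := fun x y h => (zer Pt P0 x y h).2
  have P22 : ∀ x y, (x, y) ∈ Ut → pdy (pdy Pt) x y = 0 := fun x y h => (zer _ P2 x y h).2
  have rel := fun x y (hz : (x, y) ∈ U) => rel_solved hrel hz (hdet x y hz)
    (P0 _ _ (hmaps x y hz)) rfl rfl rfl rfl rfl rfl rfl rfl rfl rfl rfl rfl rfl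
  obtain ⟨ka, va⟩ : ∃ k : SmAlg U, k = mkS _ sax := ⟨_, rfl⟩
  obtain ⟨kb, vb⟩ : ∃ k : SmAlg U, k = mkS _ say := ⟨_, rfl⟩
  obtain ⟨kc, vc⟩ : ∃ k : SmAlg U, k = mkS _ scx := ⟨_, rfl⟩
  obtain ⟨ke, ve⟩ : ∃ k : SmAlg U, k = mkS _ scy := ⟨_, rfl⟩
  obtain ⟨kP, vP⟩ : ∃ k : SmAlg U, k = mkS _ hP := ⟨_, rfl⟩
  obtain ⟨kQ, vQ⟩ : ∃ k : SmAlg U, k = mkS _ hQ := ⟨_, rfl⟩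
  obtain ⟨kR, vR⟩ : ∃ k : SmAlg U, k = mkS _ hR := ⟨_, rfl⟩
  obtain ⟨kS, vS⟩ : ∃ k : SmAlg U, k = mkS _ hS := ⟨_, rfl⟩
  obtain ⟨kt1, vt1⟩ : ∃ k : SmAlg U, k = mkS _ st1 := ⟨_, rfl⟩
  obtain ⟨kt2, vt2⟩ : ∃ k : SmAlg U, k = mkS _ st2 := ⟨_, rfl⟩
  obtain ⟨kq, vq⟩ : ∃ k : SmAlg U, k = mkS _ (cm hQt) := ⟨_, rfl⟩
  obtain ⟨kr, vr⟩ : ∃ k : SmAlg U, k = mkS _ (cm hRt) := ⟨_, rfl⟩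
  obtain ⟨ks, vs⟩ : ∃ k : SmAlg U, k = mkS _ (cm hSt) := ⟨_, rfl⟩
  have hax : dirD hU (1, 0) ka = ka * (kQ + 2 * kt1) - kb * kP - (kq * ka * ka + 2 * kr * ka * kc + ks * kc * kc) := by
    subst va vb vc ve vP vQ vR vS vt1 vt2 vq vr vs
    exact Subtype.ext (funext fun z => ((reps_mkS _ sax).dx hU z).trans
      (rel z.1.1 z.1.2 z.2).1)
  have hcx : dirD hU (1, 0) kc = kc * (kQ + 2 * kt1) - ke * kP + (2 * kq * ka * kc + kr * kc * kc) := by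
    subst va vb vc ve vP vQ vR vS vt1 vt2 vq vr vs
    exact Subtype.ext (funext fun z => ((reps_mkS _ scx).dx hU z).trans
      (rel z.1.1 z.1.2 z.2).2.1)
  have hay : dirD hU (0, 1) ka = ka * (kR + kt2) + kb * (kt1 - kQ) - (kq * ka * kb + kr * (ka * ke + kb * kc) + ks * kc * ke) := by
    subst va vb vc ve vP vQ vR vS vt1 vt2 vq vr vs
    exact Subtype.ext (funext fun z => ((reps_mkS _ sax).dy hU z).trans
      (rel z.1.1 z.1.2 z.2).2.2.1)
  have hbx : dirD hU (1, 0) kb = ka * (kR + kt2) + kb * (kt1 - kQ) - (kq * ka * kb + kr * (ka * ke + kb * kc) + ks * kc * ke) := by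
    subst va vb vc ve vP vQ vR vS vt1 vt2 vq vr vs
    exact Subtype.ext (funext fun z => ((reps_mkS _ say).dx hU z).trans
      (rel z.1.1 z.1.2 z.2).2.2.2.1)
  have hcy : dirD hU (0, 1) kc = kc * (kR + kt2) + ke * (kt1 - kQ) + (kq * (ka * ke + kb * kc) + kr * kc * ke) := by
    subst va vb vc ve vP vQ vR vS vt1 vt2 vq vr vs
    exact Subtype.ext (funext fun z => ((reps_mkS _ scx).dy hU z).trans
      (rel z.1.1 z.1.2 z.2).2.2.2.2.1)
  have hex : dirD hU (1, 0) ke = kc * (kR + kt2) + ke * (kt1 - kQ) + (kq * (ka * ke + kb * kc) + kr * kc * ke) := by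
    subst va vb vc ve vP vQ vR vS vt1 vt2 vq vr vs
    exact Subtype.ext (funext fun z => ((reps_mkS _ scy).dx hU z).trans
      (rel z.1.1 z.1.2 z.2).2.2.2.2.2.1)
  have hby : dirD hU (0, 1) kb = ka * kS + kb * (2 * kt2 - kR) - (kq * kb * kb + 2 * kr * kb * ke + ks * ke * ke) := by
    subst va vb vc ve vP vQ vR vS vt1 vt2 vq vr vs
    exact Subtype.ext (funext fun z => ((reps_mkS _ say).dy hU z).trans
      (rel z.1.1 z.1.2 z.2).2.2.2.2.2.2.1)
  have hey : dirD hU (0, 1) ke = kc * kS + ke * (2 * kt2 - kR) + (2 * kq * kb * ke + kr * ke * ke) := by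
    subst va vb vc ve vP vQ vR vS vt1 vt2 vq vr vs
    exact Subtype.ext (funext fun z => ((reps_mkS _ scy).dy hU z).trans
      (rel z.1.1 z.1.2 z.2).2.2.2.2.2.2.2)
  have hDK : ∀ z : SmAlg U, (ka * ke - kb * kc) * z = 0 → z = 0 := by
    subst va vb vc ve
    intro w hw
    ext ⟨⟨x, y⟩, hz⟩
    have h := congrFun (congrArg Subtype.val hw) ⟨(x, y), hz⟩
    exact (mul_eq_zero.1 h).resolve_left (hdet x y hz)
  have main := core_alg (dirD hU (1, 0)) (dirD hU (0, 1)) (dirD_comm hU _ _)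
    ka kb kc ke kP kQ kR kS kt1 kt2 kq kr ks
    (mkS _ (cm sq1)) (mkS _ (cm sq2)) (mkS _ (cm sr1)) (mkS _ (cm sr2)) (mkS _ (cm ss1))
    (mkS _ (cm ss2)) (mkS _ (cm sq11)) (mkS _ (cm sq12)) (mkS _ (cm sq22)) (mkS _ (cm sr11))
    (mkS _ (cm sr12)) (mkS _ (cm sr22)) (mkS _ (cm ss11)) (mkS _ (cm ss12)) hDK
    hax hcx hay hbx hcy hex hby hey
    (by subst va vb vc ve vq; exact (chx hQt _ _ sq1 sq2 (rfl2 _) (rfl2 _)))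
    (by subst va vb vc ve vq; exact (chy hQt _ _ sq1 sq2 (rfl2 _) (rfl2 _)))
    (by subst va vb vc ve vr; exact (chx hRt _ _ sr1 sr2 (rfl2 _) (rfl2 _)))
    (by subst va vb vc ve vr; exact (chy hRt _ _ sr1 sr2 (rfl2 _) (rfl2 _)))
    (by subst va vb vc ve vs; exact (chx hSt _ _ ss1 ss2 (rfl2 _) (rfl2 _)))
    (by subst va vb vc ve vs; exact (chy hSt _ _ ss1 ss2 (rfl2 _) (rfl2 _)))
    (by subst va vb vc ve; exact (chx sq1 _ _ sq11 sq12 (rfl2 _) cQ))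
    (by subst va vb vc ve; exact (chy sq1 _ _ sq11 sq12 (rfl2 _) cQ))
    (by subst va vb vc ve; exact (chx sq2 _ _ sq12 sq22 (rfl2 _) (rfl2 _)))
    (by subst va vb vc ve; exact (chy sq2 _ _ sq12 sq22 (rfl2 _) (rfl2 _)))
    (by subst va vb vc ve; exact (chx sr1 _ _ sr11 sr12 (rfl2 _) cR))
    (by subst va vb vc ve; exact (chy sr1 _ _ sr11 sr12 (rfl2 _) cR))
    (by subst va vb vc ve; exact (chx sr2 _ _ sr12 sr22 (rfl2 _) (rfl2 _)))
    (by subst va vb vc ve; exact (chy sr2 _ _ sr12 sr22 (rfl2 _) (rfl2 _)))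
    (by subst va vb vc ve; exact (chx ss1 _ _ ss11 ss12 (rfl2 _) cS))
    (by subst va vb vc ve; exact (chy ss1 _ _ ss11 ss12 (rfl2 _) cS))
    (by
      subst vq
      ext ⟨⟨x, y⟩, hz⟩
      have hm := hmaps x y hz
      have h := (hspec _ _ hm).1
      rw [coefA, P0 _ _ hm, P1 _ _ hm, P2 _ _ hm, P22 _ _ hm] at h
      refine Eq.trans ?_ h
      show -2 * pdx (pdy Qt) (xt x y) (yt x y) + pdx (pdx Rt) (xt x y) (yt x y)
        - 3 * Qt (xt x y) (yt x y) * pdx Rt (xt x y) (yt x y)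
        + 6 * Qt (xt x y) (yt x y) * pdy Qt (xt x y) (yt x y) = _
      ring)
    (by
      subst vq vr vs
      ext ⟨⟨x, y⟩, hz⟩
      have hm := hmaps x y hz
      have h := (hspec _ _ hm).2.1
      rw [coefB, P0 _ _ hm, P2 _ _ hm] at h
      refine Eq.trans ?_ h
      show pdx (pdx St) (xt x y) (yt x y) - 2 * pdx (pdy Rt) (xt x y) (yt x y)
        + pdy (pdy Qt) (xt x y) (yt x y)
        + 3 * St (xt x y) (yt x y) * pdx Qt (xt x y) (yt x y)
        + 3 * Qt (xt x y) (yt x y) * pdx St (xt x y) (yt x y)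
        + 3 * Rt (xt x y) (yt x y) * pdy Qt (xt x y) (yt x y)
        - 6 * Rt (xt x y) (yt x y) * pdx Rt (xt x y) (yt x y) = _
      ring)
  obtain ⟨hAK, hBK⟩ := main
  obtain ⟨hAy, hBx, hBy⟩ := core_deriv (dirD hU (1, 0)) (dirD hU (0, 1))
    ka kb kc ke kP kQ kR kS kt1 kt2 kq kr ks hax hcx hay hbx hcy hex hby hey
  have eP : Reps kP P := by subst vP; exact reps_mkS _ _
  have eQ : Reps kQ Q := by subst vQ; exact reps_mkS _ _
  have eR : Reps kR R := by subst vR; exact reps_mkS _ _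
  have eS : Reps kS S := by subst vS; exact reps_mkS _ _
  have rA : Reps ((ka * ke - kb * kc) * kc) (coefA P Q R S) := by
    rw [← hAK]
    intro z
    rw [coefA, ← eP z, ← eQ z, ← eR z, ← eS z, ← (eP.dy hU).dy hU z, ← (eQ.dy hU).dx hU z,
      ← (eR.dx hU).dx hU z, ← eS.dx hU z, ← eP.dx hU z, ← eR.dy hU z, ← eP.dy hU z,
      ← eR.dx hU z, ← eQ.dy hU z]
    rfl
  have rB : Reps ((ka * ke - kb * kc) * ke) (coefB P Q R S) := by
    rw [← hBK]
    intro z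
    rw [coefB, ← eP z, ← eQ z, ← eR z, ← eS z, ← (eS.dx hU).dx hU z, ← (eR.dy hU).dx hU z,
      ← (eQ.dy hU).dy hU z, ← eP.dy hU z, ← eS.dy hU z, ← eQ.dx hU z, ← eS.dx hU z,
      ← eQ.dy hU z, ← eR.dx hU z]
    rfl
  intro x y hz
  have fA := rA ⟨(x, y), hz⟩
  have fB := rB ⟨(x, y), hz⟩
  have fAy := rA.dy hU ⟨(x, y), hz⟩
  have fBx := rB.dx hU ⟨(x, y), hz⟩
  have fBy := rB.dy hU ⟨(x, y), hz⟩
  rw [hAy] at fAy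
  rw [hBx] at fBx
  rw [hBy] at fBy
  subst va vb vc ve vP vQ vR vS vt1 vt2 vq vr vs
  have F := final_alg (hdet x y hz) rfl fA.symm fB.symm (hB x y hz) fAy.symm fBx.symm fBy.symm
  have m3 : ∀ u : ℝ, 3 * (u / 3) = u := fun u => by ring
  simp only [phiPull, Fin.sum_univ_two]
  refine ⟨Eq.trans ?_ F.1, Eq.trans ?_ F.2⟩
  · show _ = _ - 3 * (sigmaT xt yt 0 x y / 3)
    rw [m3]; rfl
  · show _ = _ - 3 * (sigmaT xt yt 1 x y / 3)
    rw [m3]; rfl
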